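/- Assume each utility u_i is continuous, strictly increasing, quasiconcave, and differentiable on the interior of ℝ_{≥0}^K, and that the map assigning to each income distribution its (unique) Walrasian equilibrium price is continuous. Then for any strictly positive endowments ω_1,…,ω_N ∈ ℝ_{>0}^K with Σ_i ω_i = w, there exists a Walrasian equilibrium from endowments ω, i.e. a pair (x,p) with x ∈ F(w) and p ∈ Σ_K^+(w) such that for every i, ⟨p,x_i⟩ = ⟨p,ω_i⟩ and u_i(x_i) = v_i(p, ⟨p,ω_i⟩); moreover the allocation of any such equilibrium is Pareto optimal. -/

import Mathlib

/-- Euclidean inner product on `ℝ^K`. -/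
noncomputable def dot {K : ℕ} (p x : Fin K → ℝ) : ℝ := ∑ k, p k * x k

/-- Membership in the nonnegative orthant `ℝ_{≥0}^K`. -/
def nonneg {K : ℕ} (x : Fin K → ℝ) : Prop := ∀ k, 0 ≤ x k

/-- Strictly positive price vector. -/
def posVec {K : ℕ} (p : Fin K → ℝ) : Prop := ∀ k, 0 < p k

/-- `v` is the indirect utility of `u`: for every strictly positive price `p` and income
`m ≥ 0`, `v p m` is the maximum of `u` over the budget set
`{x ∈ ℝ_{≥0}^K : ⟨p,x⟩ ≤ m}`. -/
def IsIndirectUtility {K : ℕ} (u : (Fin K → ℝ) → ℝ) (v : (Fin K → ℝ) → ℝ → ℝ) : Prop :=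
  ∀ p m, posVec p → 0 ≤ m →
    IsGreatest {t | ∃ x, nonneg x ∧ dot p x ≤ m ∧ u x = t} (v p m)

/-- The set of feasible allocations `F(w)`. -/
def Feasible {K N : ℕ} (w : Fin K → ℝ) (x : Fin N → Fin K → ℝ) : Prop :=
  (∀ i, nonneg (x i)) ∧ ∀ k, (∑ i, x i k) ≤ w k

/-- Normalized strictly positive prices `Σ_K^+(w)`. -/
def PriceSimplex {K : ℕ} (w p : Fin K → ℝ) : Prop := posVec p ∧ dot p w = 1

/-- Income distributions `Σ_N`. -/
def IncomeSimplex {N : ℕ} (m : Fin N → ℝ) : Prop := (∀ i, 0 ≤ m i) ∧ (∑ i, m i) = 1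

/-- The utility possibility set. -/
def UPS {K N : ℕ} (w : Fin K → ℝ) (u : Fin N → (Fin K → ℝ) → ℝ) : Set (Fin N → ℝ) :=
  {e | ∃ x, Feasible w x ∧ ∀ i, e i = u i (x i)}

/-- The indirect utility possibility set. -/
def VPS {K N : ℕ} (w : Fin K → ℝ) (v : Fin N → (Fin K → ℝ) → ℝ → ℝ) : Set (Fin N → ℝ) :=
  {e | ∃ p m, PriceSimplex w p ∧ IncomeSimplex m ∧ ∀ i, e i = v i p (m i)}

/-- A Walrasian equilibrium with income distribution `m`. -/
def WalrasEq {K N : ℕ} (w : Fin K → ℝ) (u : Fin N → (Fin K → ℝ) → ℝ)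
    (v : Fin N → (Fin K → ℝ) → ℝ → ℝ)
    (x : Fin N → Fin K → ℝ) (p : Fin K → ℝ) (m : Fin N → ℝ) : Prop :=
  Feasible w x ∧ PriceSimplex w p ∧ ∀ i, dot p (x i) = m i ∧ u i (x i) = v i p (m i)

/-- Pareto optimality of an allocation `x ∈ F(w)`. -/
def ParetoOptimal {K N : ℕ} (w : Fin K → ℝ) (u : Fin N → (Fin K → ℝ) → ℝ)
    (x : Fin N → Fin K → ℝ) : Prop :=
  Feasible w x ∧
    ¬ ∃ x', Feasible w x' ∧ (∀ i, u i (x i) ≤ u i (x' i)) ∧ ∃ j, u j (x j) < u j (x' j)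

open Finset in
/-- In a set `R` of `card I` points on which the colouring `c` misses some colour, the facets on
which `c` misses exactly the colour `i₀` are even in number. -/
theorem even_card_almost_rainbow_facets {I X : Type*} [Fintype I] [DecidableEq I] [Fintype X]
    [DecidableEq X] (c : X → I) (i₀ : I) (R : Finset X) (hR : #R = Fintype.card I)
    (hc : R.image c ≠ univ) :
    Even #{D : Finset X | (#D + 1 = Fintype.card I ∧ D.image c = univ.erase i₀) ∧ D ⊆ R} := by
  set F : Finset (Finset X) :=
    {D : Finset X | (#D + 1 = Fintype.card I ∧ D.image c = univ.erase i₀) ∧ D ⊆ R} with hF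
  rcases F.eq_empty_or_nonempty with h0 | ⟨D, hD⟩
  · simp [h0]
  obtain ⟨⟨hDc, hDi⟩, hDR⟩ : (#D + 1 = Fintype.card I ∧ D.image c = univ.erase i₀) ∧ D ⊆ R := by
    simpa [hF] using hD
  have hinj : Set.InjOn c D := by
    rw [← card_image_iff, hDi, card_erase_of_mem (mem_univ _), card_univ]
    omega
  obtain ⟨x, hxD, rfl⟩ : ∃ x, x ∉ D ∧ insert x D = R :=
    (exists_eq_insert_iff.2 ⟨hDR, by omega⟩)
  have hcx : c x ∈ univ.erase i₀ := by
    by_contra h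
    have hx0 : c x = i₀ := by simpa using h
    apply hc
    rw [image_insert, hDi, hx0, insert_erase (mem_univ _)]
  rw [← hDi] at hcx
  obtain ⟨x', hx'D, hx'⟩ := mem_image.1 hcx
  have hne : x ≠ x' := by rintro rfl; exact hxD hx'D
  set E := insert x (D.erase x') with hE
  have hxE : x ∉ D.erase x' := fun h ↦ hxD (mem_of_mem_erase h)
  have hEc : #E = #D := by
    rw [hE, card_insert_of_notMem hxE, card_erase_of_mem hx'D]
    have := card_pos.2 ⟨x', hx'D⟩
    omega
  have hEi : E.image c = univ.erase i₀ := by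
    rw [hE, image_insert, ← hx', ← image_insert, insert_erase hx'D, hDi]
  have hEF : F = {D, E} := by
    ext G
    simp only [hF, mem_filter, mem_univ, true_and, mem_insert, mem_singleton]
    constructor
    · rintro ⟨⟨hGc, hGi⟩, hGR⟩
      obtain ⟨z, hzG, hz⟩ := exists_eq_insert_iff.2 ⟨hGR, by omega⟩
      have hzR : z ∈ insert x D := hz ▸ mem_insert_self z G
      have hGz : G = (insert x D).erase z := by rw [← hz, erase_insert hzG]
      rcases mem_insert.1 hzR with rfl | hzD
      · left
        rw [hGz, erase_insert hxD]
      · right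
        suffices z = x' by
          rw [hGz, hE, this, erase_insert_of_ne hne]
        have hcz : c z ∈ G.image c := by
          rw [hGi, ← hDi]
          exact mem_image_of_mem c hzD
        obtain ⟨z', hz'G, hz'⟩ := mem_image.1 hcz
        have hz'z : z' ≠ z := by rintro rfl; exact hzG hz'G
        rcases mem_insert.1 (hGR hz'G) with rfl | hz'D
        · exact hinj hzD hx'D (hz'.symm.trans hx'.symm)
        · exact absurd (hinj hz'D hzD hz') hz'z
    · rintro (rfl | rfl)
      · exact ⟨⟨hDc, hDi⟩, hDR⟩
      · exact ⟨⟨by omega, hEi⟩, insert_subset_insert _ (erase_subset _ _)⟩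
  have hDE : D ≠ E := by
    intro h
    exact hxD (h ▸ mem_insert_self x _)
  rw [hEF, card_pair hDE]
  exact even_two

/-- No point lies strictly above the `r i`-minimum of `S` for every index `i`. -/
def Dominant {I X α : Type*} [LinearOrder α] (r : I → X → α) (S : Finset X) : Prop :=
  ∀ y, ∃ i, ∀ x ∈ S, r i y ≤ r i x

open Finset in
open Classical in
/-- Pivoting: a facet containing a genuine point `Sum.inl t` lies in an even number of dominant
sets of full size. -/
theorem even_card_dominant_above {I T α : Type*} [Fintype I] [Fintype T] [LinearOrder α]
    (r : I → T ⊕ I → α) (hr : ∀ i, Function.Injective (r i))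
    (hhigh : ∀ i j t, j ≠ i → r i (Sum.inl t) < r i (Sum.inr j))
    (D : Finset (T ⊕ I)) (hD : #D + 1 = Fintype.card I) (t : T) (ht : Sum.inl t ∈ D) :
    Even #{R : Finset (T ⊕ I) | (#R = Fintype.card I ∧ Dominant r R) ∧ D ⊆ R} := by
  set F : Finset (Finset (T ⊕ I)) :=
    {R : Finset (T ⊕ I) | (#R = Fintype.card I ∧ Dominant r R) ∧ D ⊆ R} with hF
  rcases F.eq_empty_or_nonempty with h0 | ⟨R₀, hR₀⟩
  · simp [h0]
  have hdom : Dominant r D := by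
    obtain ⟨⟨-, h⟩, hs⟩ : (#R₀ = Fintype.card I ∧ Dominant r R₀) ∧ D ⊆ R₀ := by
      simpa [hF] using hR₀
    exact fun y ↦ (h y).imp fun i hi x hx ↦ hi x (hs hx)
  choose m hmD hm using fun i ↦ D.exists_min_image (r i) ⟨_, ht⟩
  have hmeq : ∀ i, ∀ d ∈ D, (∀ x ∈ D, r i d ≤ r i x) → m i = d := fun i d hd h ↦
    hr i (le_antisymm (hm i d hd) (h _ (hmD i)))
  have hsurj : ∀ d ∈ D, ∃ i, m i = d := fun d hd ↦
    (hdom d).imp fun i hi ↦ hmeq i d hd hi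
  obtain ⟨i, -, j, -, hij, hmij⟩ := exists_ne_map_eq_of_card_lt_of_maps_to
    (s := (univ : Finset I)) (t := D) (f := m) (by rw [card_univ]; omega) (fun i _ ↦ hmD i)
  -- deleting `k` keeps `m` onto `D` exactly for `k = i` and `k = j`
  have hcov : ∀ k, (k = i ∨ k = j) → ∀ d ∈ D, ∃ l, l ≠ k ∧ m l = d := by
    intro k hk d hd
    obtain ⟨l, rfl⟩ := hsurj d hd
    by_cases hlk : l = k
    · subst hlk
      rcases hk with rfl | rfl
      exacts [⟨j, hij.symm, hmij.symm⟩, ⟨i, hij, hmij⟩]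
    · exact ⟨l, hlk, rfl⟩
  have hfew : ∀ A : Finset I, (∀ d ∈ D, ∃ l ∈ A, m l = d) → #D ≤ #A := by
    intro A hA
    have : D ⊆ A.image m := fun d hd ↦ mem_image.2 (hA d hd)
    exact (card_le_card this).trans card_image_le
  have hcov' : ∀ k, (∀ d ∈ D, ∃ l, l ≠ k ∧ m l = d) → k = i ∨ k = j := by
    intro k hk
    by_contra! hne
    have h1 : #D ≤ #((univ.erase k).erase i) := by
      refine hfew _ fun d hd ↦ ?_
      obtain ⟨l, hlk, rfl⟩ := hk d hd
      by_cases hli : l = i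
      · exact ⟨j, by simp [hij.symm, hne.2.symm], by rw [hli, hmij]⟩
      · exact ⟨l, by simp [hli, hlk], rfl⟩
    rw [card_erase_of_mem (by simp [hne.1.symm]), card_erase_of_mem (mem_univ _), card_univ] at h1
    have : 2 ≤ Fintype.card I := by
      rw [← card_univ, ← card_pair hij]
      exact card_le_card (subset_univ _)
    omega
  -- the candidates for the point completing `D` while becoming the `k`-minimum
  let M : I → Finset (T ⊕ I) := fun k ↦ {y | ∀ l, l ≠ k → r l (m l) < r l y}
  have hMmem : ∀ k y, y ∈ M k ↔ ∀ l, l ≠ k → r l (m l) < r l y := by simp [M]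
  have hMne : ∀ k, (M k).Nonempty := fun k ↦
    ⟨Sum.inr k, (hMmem _ _).2 fun l hl ↦ (hm l _ ht).trans_lt (hhigh l k t hl.symm)⟩
  choose y hyM hy using fun k ↦ (M k).exists_max_image (r k) (hMne k)
  have hyD : ∀ k, (k = i ∨ k = j) → y k ∉ D := by
    intro k hk hyk
    obtain ⟨l, hlk, hl⟩ := hcov k hk _ hyk
    have := (hMmem _ _).1 (hyM k) l hlk
    rw [hl] at this
    exact lt_irrefl _ this
  have hroom : ∀ k, (k = i ∨ k = j) → insert (y k) D ∈ F := by
    intro k hk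
    simp only [hF, mem_filter, mem_univ, true_and]
    refine ⟨⟨by rw [card_insert_of_notMem (hyD k hk), hD], fun z ↦ ?_⟩, subset_insert _ _⟩
    by_cases hz : z ∈ M k
    · refine ⟨k, fun x hx ↦ (hy k z hz).trans ?_⟩
      rcases mem_insert.1 hx with rfl | hxD
      · exact le_rfl
      · obtain ⟨l, hl⟩ := hdom (y k)
        by_cases hlk : l = k
        · subst hlk
          exact hl x hxD
        · exact absurd (hl _ (hmD l)) ((hMmem _ _).1 (hyM k) l hlk).not_ge
    · rw [hMmem] at hz
      push Not at hz
      obtain ⟨l, hlk, hl⟩ := hz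
      refine ⟨l, fun x hx ↦ hl.trans ?_⟩
      rcases mem_insert.1 hx with rfl | hx
      · exact ((hMmem _ _).1 (hyM k) l hlk).le
      · exact hm l x hx
  have hyij : y i ≠ y j := by
    intro h
    obtain ⟨l, hl⟩ := hdom (y i)
    have hlt : r l (m l) < r l (y i) := by
      by_cases hli : l = i
      · rw [h]
        exact (hMmem _ _).1 (hyM j) l (by rw [hli]; exact hij)
      · exact (hMmem _ _).1 (hyM i) l hli
    exact hlt.not_ge (hl _ (hmD l))
  have hne : insert (y i) D ≠ insert (y j) D := by
    intro h
    have : y i ∈ insert (y j) D := h ▸ mem_insert_self _ _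
    rcases mem_insert.1 this with h | h
    exacts [hyij h, hyD i (Or.inl rfl) h]
  have hFeq : F = {insert (y i) D, insert (y j) D} := by
    ext R
    rw [mem_insert, mem_singleton]
    constructor
    · intro hR
      obtain ⟨⟨hRc, hRd⟩, hDR⟩ : (#R = Fintype.card I ∧ Dominant r R) ∧ D ⊆ R := by
        simpa [hF] using hR
      obtain ⟨z, hzD, rfl⟩ := exists_eq_insert_iff.2 ⟨hDR, by omega⟩
      obtain ⟨k, hk⟩ := hRd z
      have hexcl : ∀ l, (∀ x ∈ insert z D, r l z ≤ r l x) → ∀ d ∈ D,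
          ¬ ∀ x ∈ insert z D, r l d ≤ r l x := by
        intro l hl d hd hld
        have := hr l (le_antisymm (hl d (mem_insert_of_mem hd)) (hld z (mem_insert_self _ _)))
        exact hzD (this ▸ hd)
      have hk' : k = i ∨ k = j := by
        refine hcov' k fun d hd ↦ ?_
        obtain ⟨l, hl⟩ := hRd d
        refine ⟨l, ?_, hmeq l d hd fun x hx ↦ hl x (mem_insert_of_mem hx)⟩
        rintro rfl
        exact hexcl l hk d hd hl
      have hzM : z ∈ M k := by
        rw [hMmem]
        intro l hlk
        by_contra! hle
        have hl' : ∀ x ∈ insert z D, r l z ≤ r l x := by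
          intro x hx
          rcases mem_insert.1 hx with rfl | hx
          exacts [le_rfl, hle.trans (hm l x hx)]
        have h1 : #D ≤ #((univ.erase k).erase l) := by
          refine hfew _ fun d hd ↦ ?_
          obtain ⟨a, ha⟩ := hRd d
          refine ⟨a, ?_, hmeq a d hd fun x hx ↦ ha x (mem_insert_of_mem hx)⟩
          simp only [mem_erase, mem_univ, and_true]
          refine ⟨?_, ?_⟩
          · rintro rfl
            exact hexcl a hl' d hd ha
          · rintro rfl
            exact hexcl a hk d hd ha
        rw [card_erase_of_mem (by simp [hlk]), card_erase_of_mem (mem_univ _), card_univ] at h1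
        have : 2 ≤ Fintype.card I := by
          rw [← card_univ, ← card_pair hij]
          exact card_le_card (subset_univ _)
        omega
      have hzy : z = y k := by
        obtain ⟨l, hl⟩ := hRd (y k)
        by_cases hlk : l = k
        · subst hlk
          exact hr l (le_antisymm (hy l z hzM) (hl z (mem_insert_self _ _)))
        · exact absurd (hl _ (mem_insert_of_mem (hmD l)))
            ((hMmem _ _).1 (hyM k) l hlk).not_ge
      rcases hk' with rfl | rfl
      exacts [Or.inl (by rw [hzy]), Or.inr (by rw [hzy])]
    · rintro (rfl | rfl)
      exacts [hroom i (Or.inl rfl), hroom j (Or.inr rfl)]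
  rw [hFeq, card_pair hne]
  exact even_two

open Finset in
open Classical in
/-- The outer facet consisting of all slack points but one lies in exactly one dominant set of
full size. -/
theorem card_dominant_above_slack {I T α : Type*} [Fintype I] [Fintype T] [Nonempty T]
    [LinearOrder α] (r : I → T ⊕ I → α) (hr : ∀ i, Function.Injective (r i))
    (hlow : ∀ i t, r i (Sum.inr i) < r i (Sum.inl t))
    (hhigh : ∀ i j t, j ≠ i → r i (Sum.inl t) < r i (Sum.inr j)) (i₀ : I) :
    #{R : Finset (T ⊕ I) | (#R = Fintype.card I ∧ Dominant r R) ∧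
      (univ.erase i₀).image Sum.inr ⊆ R} = 1 := by
  set D : Finset (T ⊕ I) := (univ.erase i₀).image Sum.inr with hDdef
  have hD : #D + 1 = Fintype.card I := by
    rw [hDdef, card_image_of_injective _ Sum.inr_injective, card_erase_of_mem (mem_univ _),
      card_univ]
    have : 0 < Fintype.card I := Fintype.card_pos_iff.2 ⟨i₀⟩
    omega
  have hDmem : ∀ i, i ≠ i₀ → Sum.inr i ∈ D := fun i hi ↦ by simp [hDdef, hi]
  obtain ⟨t, -, ht⟩ := (univ : Finset T).exists_max_image (fun t ↦ r i₀ (Sum.inl t))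
    univ_nonempty
  have htD : Sum.inl t ∉ D := by simp [hDdef]
  rw [card_eq_one]
  refine ⟨insert (Sum.inl t) D, ?_⟩
  ext R
  simp only [mem_filter, mem_univ, true_and, mem_singleton]
  constructor
  · rintro ⟨⟨hRc, hRd⟩, hDR⟩
    obtain ⟨z, hzD, rfl⟩ := exists_eq_insert_iff.2 ⟨hDR, by omega⟩
    obtain ⟨i, hi⟩ := hRd (Sum.inl t)
    have hi0 : i = i₀ := by
      by_contra h
      exact (hlow i t).not_ge (hi _ (mem_insert_of_mem (hDmem i h)))
    subst hi0
    rcases z with s | j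
    · have := hr i (le_antisymm (hi _ (mem_insert_self _ _)) (ht s (mem_univ _)))
      rw [this]
    · have hj : j = i := by
        by_contra h
        exact hzD (hDmem j h)
      subst hj
      exact absurd (hi _ (mem_insert_self _ _)) (hlow j t).not_ge
  · rintro rfl
    refine ⟨⟨by rw [card_insert_of_notMem htD, hD], ?_⟩, subset_insert _ _⟩
    rintro (s | j)
    · refine ⟨i₀, fun x hx ↦ ?_⟩
      rcases mem_insert.1 hx with rfl | hx
      · exact ht s (mem_univ _)
      · obtain ⟨i, hi, rfl⟩ := mem_image.1 hx
        exact (hhigh i₀ i s (by simpa using hi)).le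
    · refine ⟨j, fun x _ ↦ ?_⟩
      rcases x with s | i
      · exact (hlow j s).le
      · by_cases h : i = j
        · rw [h]
        · exact ((hlow j t).trans (hhigh j i t h)).le

open Finset in
open Classical in
/-- **Scarf's lemma**: some dominant set of full size carries every colour. -/
theorem exists_rainbow_dominant {I T α : Type*} [Fintype I] [Nonempty I] [Fintype T] [Nonempty T]
    [LinearOrder α] (r : I → T ⊕ I → α) (hr : ∀ i, Function.Injective (r i))
    (hlow : ∀ i t, r i (Sum.inr i) < r i (Sum.inl t))
    (hhigh : ∀ i j t, j ≠ i → r i (Sum.inl t) < r i (Sum.inr j)) (c : T → I) :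
    ∃ R : Finset (T ⊕ I), Dominant r R ∧ R.image (Sum.elim c id) = univ := by
  by_contra! hno
  let i₀ : I := Classical.arbitrary I
  set C : T ⊕ I → I := Sum.elim c id with hC
  let rooms : Finset (Finset (T ⊕ I)) := {R | #R = Fintype.card I ∧ Dominant r R}
  let doors : Finset (Finset (T ⊕ I)) :=
    {D | #D + 1 = Fintype.card I ∧ D.image C = univ.erase i₀}
  set D₀ : Finset (T ⊕ I) := (univ.erase i₀).image Sum.inr with hD₀
  have hD₀mem : D₀ ∈ doors := by
    simp only [doors, mem_filter, mem_univ, true_and]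
    constructor
    · rw [hD₀, card_image_of_injective _ Sum.inr_injective, card_erase_of_mem (mem_univ _),
        card_univ]
      have : 0 < Fintype.card I := Fintype.card_pos
      omega
    · rw [hD₀, image_image]
      ext i
      simp [hC]
  have hcount := sum_card_bipartiteAbove_eq_sum_card_bipartiteBelow
    (s := doors) (t := rooms) (fun D R ↦ D ⊆ R)
  have hright : Even (∑ R ∈ rooms, #(doors.bipartiteBelow (fun D R ↦ D ⊆ R) R)) := by
    refine even_sum _ fun R hR ↦ ?_
    obtain ⟨h1, h2⟩ : #R = Fintype.card I ∧ Dominant r R := by simpa [rooms] using hR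
    have := even_card_almost_rainbow_facets C i₀ R h1 (hno R h2)
    simpa only [bipartiteBelow, doors, filter_filter] using this
  have hleft : Even (∑ D ∈ doors.erase D₀, #(rooms.bipartiteAbove (fun D R ↦ D ⊆ R) D)) := by
    refine even_sum _ fun D hD ↦ ?_
    obtain ⟨hne, hD⟩ := mem_erase.1 hD
    obtain ⟨h1, h2⟩ : #D + 1 = Fintype.card I ∧ D.image C = univ.erase i₀ := by
      simpa [doors] using hD
    obtain ⟨t, ht⟩ : ∃ t, Sum.inl t ∈ D := by
      by_contra! hT
      apply hne
      refine eq_of_subset_of_card_le ?_ ?_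
      · rintro (t | i) hx
        · exact absurd hx (hT t)
        · have := mem_image_of_mem C hx
          rw [h2] at this
          exact mem_image_of_mem _ this
      · have := (mem_filter.1 hD₀mem).2.1
        omega
    have := even_card_dominant_above r hr hhigh D h1 t ht
    simpa only [bipartiteAbove, rooms, filter_filter] using this
  have hone : #(rooms.bipartiteAbove (fun D R ↦ D ⊆ R) D₀) = 1 := by
    have := card_dominant_above_slack r hr hlow hhigh i₀
    simpa only [bipartiteAbove, rooms, filter_filter] using this
  rw [← hcount, ← add_sum_erase _ _ hD₀mem, hone] at hright
  rw [Nat.even_add] at hright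
  simp [hleft] at hright

open Finset in
/-- **Sperner-type lemma**: every colouring of the grid points of the `n`-fold dilated standard
simplex has a small cluster of points in which each colour `i` is either attained or has a
negligible coordinate. -/
theorem exists_rainbow_cluster {I : Type*} [Fintype I] [Nonempty I] (n : ℕ)
    (c : (I → ℕ) → I) :
    ∃ a : I → ℕ, ∑ i, a i = n ∧ ∀ i, ∃ b : I → ℕ, ∑ i, b i = n ∧
      (∀ j, b j ≤ a j + Fintype.card I ∧ a j ≤ b j + Fintype.card I) ∧
      (c b = i ∨ b i ≤ Fintype.card I) := by
  classical
  let A : Finset (I → ℕ) := piAntidiag univ n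
  let T := {a : I → ℕ // a ∈ A}
  have : Fintype T := A.fintypeCoeSort
  have hsum : ∀ a : T, ∑ i, a.1 i = n := fun a ↦ (mem_piAntidiag.1 a.2).1
  have hmemT : ∀ a : I → ℕ, ∑ i, a i = n → a ∈ A := fun a ha ↦
    mem_piAntidiag.2 ⟨ha, by simp⟩
  let i₁ : I := Classical.arbitrary I
  have : Nonempty T := ⟨⟨Pi.single i₁ n, hmemT _ (by simp)⟩⟩
  let e := Fintype.equivFin (T ⊕ I)
  let key : I → T ⊕ I → ℕ := fun i ↦
    Sum.elim (fun a ↦ a.1 i + 1) (fun j ↦ if j = i then 0 else n + 2)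
  let r : I → T ⊕ I → ℕ ×ₗ Fin (Fintype.card (T ⊕ I)) := fun i x ↦ toLex (key i x, e x)
  have hlt : ∀ i x y, key i x < key i y → r i x < r i y := fun i x y h ↦
    Prod.Lex.toLex_lt_toLex.2 (Or.inl h)
  have hle : ∀ (a : T) i, a.1 i ≤ n := fun a i ↦
    (single_le_sum (fun _ _ ↦ Nat.zero_le _) (mem_univ i)).trans (hsum a).le
  have hlow : ∀ i t, r i (Sum.inr i) < r i (Sum.inl t) := fun i t ↦
    hlt _ _ _ (by simp [key])
  have hhigh : ∀ i j t, j ≠ i → r i (Sum.inl t) < r i (Sum.inr j) := fun i j t hj ↦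
    hlt _ _ _ (by have := hle t i; simp only [key, Sum.elim_inl, Sum.elim_inr, if_neg hj]; omega)
  have hinj : ∀ i, Function.Injective (r i) := by
    intro i x y h
    have h' : (key i x, e x) = (key i y, e y) := toLex.injective h
    exact e.injective (Prod.ext_iff.1 h').2
  obtain ⟨R, hdom, hR⟩ := exists_rainbow_dominant r hinj hlow hhigh fun a ↦ c a.1
  have hcol : ∀ i, Sum.inr i ∉ R → ∃ a : T, Sum.inl a ∈ R ∧ c a.1 = i := by
    intro i hi
    obtain ⟨x, hx, hxi⟩ := mem_image.1 (hR ▸ mem_univ i)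
    rcases x with a | j
    · exact ⟨a, hx, hxi⟩
    · exact absurd ((show j = i from hxi) ▸ hx) hi
  set C : Finset I := {i | Sum.inr i ∉ R} with hC
  have hCmem : ∀ i, i ∈ C ↔ Sum.inr i ∉ R := by simp [hC]
  have hbeat : ∀ b : T, ∃ i ∈ C, ∀ a : T, Sum.inl a ∈ R → b.1 i ≤ a.1 i := by
    intro b
    obtain ⟨i, hi⟩ := hdom (Sum.inl b)
    refine ⟨i, (hCmem i).2 fun h ↦ (hlow i b).not_ge (hi _ h), fun a ha ↦ ?_⟩
    by_contra! h
    exact (hlt i _ _ (by simpa [key] using h)).not_ge (hi _ ha)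
  obtain ⟨k, hkC, -⟩ := hbeat (Classical.arbitrary T)
  obtain ⟨a₀, ha₀, -⟩ := hcol k ((hCmem k).1 hkC)
  have hmin : ∀ i, ∃ a : T, Sum.inl a ∈ R ∧ ∀ a' : T, Sum.inl a' ∈ R → a.1 i ≤ a'.1 i := by
    intro i
    obtain ⟨a, ha, h⟩ := ({a | Sum.inl a ∈ R} : Finset T).exists_min_image (fun a ↦ a.1 i)
      ⟨a₀, by simpa using ha₀⟩
    exact ⟨a, by simpa using ha, fun a' ha' ↦ h a' (by simpa using ha')⟩
  choose μ hμR hμ using hmin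
  have hbig : n < ∑ i ∈ C, ((μ i).1 i + 1) := by
    by_contra! h
    let b : I → ℕ := fun i ↦ (if i ∈ C then (μ i).1 i + 1 else 0) +
      if i = k then n - ∑ i ∈ C, ((μ i).1 i + 1) else 0
    have hb : ∑ i, b i = n := by
      simp only [b, sum_add_distrib, sum_ite_mem, univ_inter, sum_ite_eq', mem_univ, if_true] at h ⊢
      omega
    obtain ⟨i, hiC, hi⟩ := hbeat ⟨b, hmemT b hb⟩
    have h1 := hi _ (hμR i)
    simp only [b, if_pos hiC] at h1
    omega
  have hCcard : #C ≤ Fintype.card I := card_le_univ C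
  rw [sum_add_distrib, sum_const, smul_eq_mul, mul_one] at hbig
  have hup : ∀ a : T, Sum.inl a ∈ R → ∀ i, i ∈ C → a.1 i ≤ (μ i).1 i + Fintype.card I := by
    intro a ha i hi
    have h1 : ∑ j ∈ C, a.1 j ≤ n :=
      (sum_le_sum_of_subset (subset_univ C)).trans (hsum a).le
    have h2 : ∑ j ∈ C.erase i, (μ j).1 j ≤ ∑ j ∈ C.erase i, a.1 j :=
      sum_le_sum fun j _ ↦ hμ j a ha
    rw [← add_sum_erase C _ hi] at h1 hbig
    omega
  have hout : ∀ a : T, Sum.inl a ∈ R → ∀ i, i ∉ C → a.1 i ≤ Fintype.card I := by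
    intro a ha i hi
    have h1 : ∑ j ∈ insert i C, a.1 j ≤ n :=
      (sum_le_sum_of_subset (subset_univ _)).trans (hsum a).le
    rw [sum_insert hi] at h1
    have h2 : ∑ j ∈ C, (μ j).1 j ≤ ∑ j ∈ C, a.1 j := sum_le_sum fun j _ ↦ hμ j a ha
    omega
  have hclose : ∀ a b : T, Sum.inl a ∈ R → Sum.inl b ∈ R → ∀ i,
      a.1 i ≤ b.1 i + Fintype.card I := by
    intro a b ha hb i
    by_cases hi : i ∈ C
    · have := hup a ha i hi
      have := hμ i b hb
      omega
    · have := hout a ha i hi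
      omega
  refine ⟨a₀.1, hsum a₀, fun i ↦ ?_⟩
  by_cases hi : i ∈ C
  · obtain ⟨b, hbR, hb⟩ := hcol i ((hCmem i).1 hi)
    exact ⟨b.1, hsum b, fun j ↦ ⟨hclose b a₀ hbR ha₀ j, hclose a₀ b ha₀ hbR j⟩, Or.inl hb⟩
  · exact ⟨a₀.1, hsum a₀, fun j ↦ ⟨hclose a₀ a₀ ha₀ ha₀ j, hclose a₀ a₀ ha₀ ha₀ j⟩,
      Or.inr (hout a₀ ha₀ i hi)⟩

open Filter Topology in
/-- **Brouwer's fixed point theorem** for the standard simplex. -/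
theorem exists_fixedPoint_stdSimplex {I : Type*} [Fintype I] [Nonempty I] (f : (I → ℝ) → I → ℝ)
    (hf : ContinuousOn f (stdSimplex ℝ I)) (hmaps : Set.MapsTo f (stdSimplex ℝ I) (stdSimplex ℝ I)) :
    ∃ x ∈ stdSimplex ℝ I, f x = x := by
  obtain ⟨N, hN⟩ : ∃ N : ℝ, N = Fintype.card I := ⟨_, rfl⟩
  have hN0 : 0 ≤ N := hN ▸ Nat.cast_nonneg _
  let g : ℕ → (I → ℕ) → I → ℝ := fun n a i ↦ (a i : ℝ) / (n + 1)
  have hpos : ∀ n : ℕ, (0 : ℝ) < n + 1 := fun n ↦ by positivity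
  have hg : ∀ n a, ∑ i, a i = n + 1 → g n a ∈ stdSimplex ℝ I := by
    intro n a ha
    refine ⟨fun i ↦ by positivity, ?_⟩
    have : (∑ i, (a i : ℝ)) = n + 1 := by exact_mod_cast ha
    simp only [g]
    rw [← Finset.sum_div, this, div_self (hpos n).ne']
  have hcol : ∀ x, ∃ i, x ∈ stdSimplex ℝ I → x i ≤ f x i := by
    intro x
    by_cases hx : x ∈ stdSimplex ℝ I
    · obtain ⟨i, -, hi⟩ := Finset.exists_le_of_sum_le (s := Finset.univ) (f := x) (g := f x)
        Finset.univ_nonempty (by rw [hx.2, (hmaps hx).2])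
      exact ⟨i, fun _ ↦ hi⟩
    · exact ⟨Classical.arbitrary I, fun h ↦ absurd h hx⟩
  choose c hc using hcol
  have hcluster : ∀ n : ℕ, ∃ x ∈ stdSimplex ℝ I, ∀ i, ∃ y ∈ stdSimplex ℝ I,
      dist y x ≤ N / (n + 1) ∧ y i ≤ f y i + N / (n + 1) := by
    intro n
    obtain ⟨a, ha, h⟩ := exists_rainbow_cluster (n + 1) fun a ↦ c (g n a)
    refine ⟨g n a, hg n a ha, fun i ↦ ?_⟩
    obtain ⟨b, hb, hab, hi⟩ := h i
    refine ⟨g n b, hg n b hb, ?_, ?_⟩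
    · rw [dist_pi_le_iff (by positivity)]
      intro j
      have h1 : (b j : ℝ) ≤ a j + N := by rw [hN]; exact_mod_cast (hab j).1
      have h2 : (a j : ℝ) ≤ b j + N := by rw [hN]; exact_mod_cast (hab j).2
      rw [Real.dist_eq, ← sub_div, abs_div, abs_of_pos (hpos n)]
      gcongr
      rw [abs_le]
      constructor <;> linarith
    · rcases hi with hi | hi
      · have := hc _ (hg n b hb)
        rw [hi] at this
        have : 0 ≤ N / (n + 1) := by positivity
        linarith
      · have h1 : (b i : ℝ) ≤ N := by rw [hN]; exact_mod_cast hi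
        have h2 : g n b i ≤ N / (n + 1) := by
          simp only [g]
          gcongr
        have := (hmaps (hg n b hb)).1 i
        linarith
  choose x hx y hy hyx hyf using hcluster
  obtain ⟨z, hz, φ, hφ, hlim⟩ := (isCompact_stdSimplex ℝ I).tendsto_subseq hx
  have hsmall : Tendsto (fun n : ℕ ↦ N / ((φ n : ℝ) + 1)) atTop (𝓝 0) := by
    have h1 : Tendsto (fun n : ℕ ↦ N / ((n : ℝ) + 1)) atTop (𝓝 0) := by
      simpa [div_eq_mul_inv] using
        (tendsto_one_div_add_atTop_nhds_zero_nat (𝕜 := ℝ)).const_mul N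
    exact h1.comp hφ.tendsto_atTop
  have hle : ∀ i, z i ≤ f z i := by
    intro i
    have hylim : Tendsto (fun n ↦ y (φ n) i) atTop (𝓝 z) := by
      refine tendsto_iff_dist_tendsto_zero.2 (squeeze_zero (fun _ ↦ dist_nonneg)
        (fun n ↦ dist_triangle _ (x (φ n)) z) ?_)
      have h2 := tendsto_iff_dist_tendsto_zero.1 hlim
      have h3 : Tendsto (fun n ↦ dist (y (φ n) i) (x (φ n))) atTop (𝓝 0) :=
        squeeze_zero (fun _ ↦ dist_nonneg) (fun n ↦ hyx (φ n) i) hsmall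
      simpa using h3.add h2
    have hfy : Tendsto (fun n ↦ f (y (φ n) i)) atTop (𝓝 (f z)) :=
      (hf z hz).tendsto.comp
        (tendsto_nhdsWithin_iff.2 ⟨hylim, Eventually.of_forall fun n ↦ hy (φ n) i⟩)
    have hfy' := (tendsto_pi_nhds.1 hfy i).add hsmall
    rw [add_zero] at hfy'
    exact le_of_tendsto_of_tendsto' (tendsto_pi_nhds.1 hylim i) hfy' fun n ↦ hyf (φ n) i
  refine ⟨z, hz, ?_⟩
  have heq := (Finset.sum_eq_sum_iff_of_le fun i _ ↦ hle i).1
    (show ∑ i, z i = ∑ i, f z i by rw [hz.2, (hmaps hz).2])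
  exact funext fun i ↦ (heq i (Finset.mem_univ i)).symm

theorem dot_sum_right {K : ℕ} {ι : Type*} (s : Finset ι) (p : Fin K → ℝ) (x : ι → Fin K → ℝ) :
    ∑ i ∈ s, dot p (x i) = dot p fun k ↦ ∑ i ∈ s, x i k := by
  simp only [dot]
  rw [Finset.sum_comm]
  exact Finset.sum_congr rfl fun k _ ↦ (Finset.mul_sum _ _ _).symm

theorem dot_le_dot_of_le {K : ℕ} {p x y : Fin K → ℝ} (hp : posVec p) (h : ∀ k, x k ≤ y k) :
    dot p x ≤ dot p y :=
  Finset.sum_le_sum fun k _ ↦ mul_le_mul_of_nonneg_left (h k) (hp k).le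

theorem dot_nonneg {K : ℕ} {p x : Fin K → ℝ} (hp : posVec p) (hx : nonneg x) : 0 ≤ dot p x :=
  Finset.sum_nonneg fun k _ ↦ mul_nonneg (hp k).le (hx k)

theorem continuous_dot_left {K : ℕ} (x : Fin K → ℝ) : Continuous fun p ↦ dot p x := by
  unfold dot
  fun_prop

/-- Under a strictly increasing utility, a bundle at least as good as the best
affordable one exhausts the budget. -/
theorem income_le_dot_of_indirectUtility_le {K : ℕ} (hK : 1 ≤ K) {u : (Fin K → ℝ) → ℝ}
    (hu : ∀ x y, nonneg x → nonneg y → (∀ k, x k ≤ y k) → x ≠ y → u x < u y)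
    {v : (Fin K → ℝ) → ℝ → ℝ} (hv : IsIndirectUtility u v) {p : Fin K → ℝ} (hp : posVec p)
    {m : ℝ} (hm : 0 ≤ m) {x : Fin K → ℝ} (hx : nonneg x) (h : v p m ≤ u x) :
    m ≤ dot p x := by
  by_contra! hlt
  let k₀ : Fin K := ⟨0, hK⟩
  set ε := (m - dot p x) / p k₀ with hε
  have hεpos : 0 < ε := div_pos (sub_pos.2 hlt) (hp k₀)
  set y : Fin K → ℝ := x + Pi.single k₀ ε with hy
  have hxy : ∀ k, x k ≤ y k := by
    intro k
    rw [hy, Pi.add_apply, Pi.single_apply]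
    split_ifs <;> linarith
  have hny : nonneg y := fun k ↦ (hx k).trans (hxy k)
  have hne : x ≠ y := by
    intro heq
    have := congrFun heq k₀
    rw [hy, Pi.add_apply, Pi.single_eq_same] at this
    linarith
  have hdot : dot p y = m := by
    have : dot p y = dot p x + p k₀ * ε := by
      simp [dot, hy, mul_add, Finset.sum_add_distrib, Pi.single_apply]
    rw [this, hε, mul_div_cancel₀ _ (hp k₀).ne']
    ring
  have h1 : u y ≤ v p m := (hv p m hp hm).2 ⟨y, hny, hdot.le, rfl⟩
  have h2 := hu x y hx hny hxy hne
  linarith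

/-- **First welfare theorem**: the allocation of a Walrasian equilibrium in which the incomes
exhaust the value of the total endowment is Pareto optimal. -/
theorem WalrasEq.paretoOptimal {K N : ℕ} (hK : 1 ≤ K) {w : Fin K → ℝ}
    {u : Fin N → (Fin K → ℝ) → ℝ}
    (hu : ∀ i x y, nonneg x → nonneg y → (∀ k, x k ≤ y k) → x ≠ y → u i x < u i y)
    {v : Fin N → (Fin K → ℝ) → ℝ → ℝ} (hv : ∀ i, IsIndirectUtility (u i) (v i))
    {x : Fin N → Fin K → ℝ} {p : Fin K → ℝ} {m : Fin N → ℝ} (h : WalrasEq w u v x p m)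
    (hm : IncomeSimplex m) : ParetoOptimal w u x := by
  obtain ⟨hx, ⟨hp, hpw⟩, hopt⟩ := h
  refine ⟨hx, ?_⟩
  rintro ⟨x', hx', hge, j, hj⟩
  have hle : ∀ i, m i ≤ dot p (x' i) := fun i ↦
    income_le_dot_of_indirectUtility_le hK (hu i) (hv i) hp (hm.1 i) (hx'.1 i)
      ((hopt i).2 ▸ hge i)
  have hlt : m j < dot p (x' j) := by
    by_contra! hle'
    have : u j (x' j) ≤ v j p (m j) := (hv j p (m j) hp (hm.1 j)).2 ⟨x' j, hx'.1 j, hle', rfl⟩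
    rw [← (hopt j).2] at this
    linarith
  have h1 : ∑ i, m i < ∑ i, dot p (x' i) :=
    Finset.sum_lt_sum (fun i _ ↦ hle i) ⟨j, Finset.mem_univ j, hlt⟩
  rw [dot_sum_right, hm.2] at h1
  have h2 := dot_le_dot_of_le hp hx'.2
  linarith

theorem incomeSimplex_dot_endowments {K N : ℕ} {w p : Fin K → ℝ} (hp : PriceSimplex w p)
    {ω : Fin N → Fin K → ℝ} (hω : ∀ i, posVec (ω i)) (hsum : ∀ k, (∑ i, ω i k) = w k) :
    IncomeSimplex fun i ↦ dot p (ω i) :=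
  ⟨fun i ↦ dot_nonneg hp.1 fun k ↦ (hω i k).le, by
    rw [dot_sum_right, funext hsum, hp.2]⟩

/-- if the map assigning to each income distribution its unique Walrasian
equilibrium price is continuous, then for any strictly positive endowments summing to `w`
a Walrasian equilibrium from those endowments exists, and every such equilibrium
allocation is Pareto optimal. -/
theorem walras_exists_from_endowments {K N : ℕ} (hK : 1 ≤ K) (hN : 1 ≤ N)
    (w : Fin K → ℝ) (hw : posVec w)
    (u : Fin N → (Fin K → ℝ) → ℝ)
    (hu_cont : ∀ i, ContinuousOn (u i) {x | nonneg x})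
    (hu_mono : ∀ i x y, nonneg x → nonneg y → (∀ k, x k ≤ y k) → x ≠ y → u i x < u i y)
    (hu_qc : ∀ i (c : ℝ), Convex ℝ {x | nonneg x ∧ c ≤ u i x})
    (hu_diff : ∀ i, DifferentiableOn ℝ (u i) {x | posVec x})
    (v : Fin N → (Fin K → ℝ) → ℝ → ℝ)
    (hv : ∀ i, IsIndirectUtility (u i) (v i))
    -- the Walrasian equilibrium price map `P : Σ_N → Σ_K^+(w)` and its properties
    (P : (Fin N → ℝ) → (Fin K → ℝ))
    (hP_eq : ∀ m, IncomeSimplex m → ∃ x, WalrasEq w u v x (P m) m)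
    (hP_unique : ∀ m, IncomeSimplex m → ∀ x p, WalrasEq w u v x p m → p = P m)
    (hP_cont : ContinuousOn P {m | IncomeSimplex m}) :
    ∀ ω : Fin N → Fin K → ℝ, (∀ i, posVec (ω i)) → (∀ k, (∑ i, ω i k) = w k) →
      (∃ x p, Feasible w x ∧ PriceSimplex w p ∧
        ∀ i, dot p (x i) = dot p (ω i) ∧ u i (x i) = v i p (dot p (ω i))) ∧
      (∀ x p, Feasible w x → PriceSimplex w p →
        (∀ i, dot p (x i) = dot p (ω i) ∧ u i (x i) = v i p (dot p (ω i))) →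
        ParetoOptimal w u x) := by
  intro ω hω hsum
  constructor
  · have : Nonempty (Fin N) := ⟨⟨0, hN⟩⟩
    obtain ⟨m, hm, hfix⟩ := exists_fixedPoint_stdSimplex (fun m i ↦ dot (P m) (ω i))
      (continuousOn_pi.2 fun i ↦ (continuous_dot_left (ω i)).comp_continuousOn hP_cont)
      (fun m hm ↦ by
        obtain ⟨x, -, hp, -⟩ := hP_eq m hm
        exact incomeSimplex_dot_endowments hp hω hsum)
    obtain ⟨x, hx, hp, hopt⟩ := hP_eq m hm
    refine ⟨x, P m, hx, hp, fun i ↦ ?_⟩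
    have hi : dot (P m) (ω i) = m i := congrFun hfix i
    rw [hi]
    exact hopt i
  · intro x p hx hp hopt
    exact WalrasEq.paretoOptimal hK hu_mono hv ⟨hx, hp, hopt⟩
      (incomeSimplex_dot_endowments hp hω hsum)
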